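/- Let a, b ∈ [1, ∞) be real numbers with 1/a + 1/b ≤ 1. Then for every positive integer N and every bilinear form A : ℝ^N × ℝ^N → ℝ, one has (∑_{k=1}^N (∑_{j=1}^N |A(e_k, e_j)|^a)^{b/a})^{1/b} ≤ ‖A‖, i.e. in this range the anisotropic Littlewood inequality holds with constant 1. -/

import Mathlib

open Finset

/-- The supremum norm of a bilinear form on `ℝ^N × ℝ^N` over the unit polydisc. -/
noncomputable def bilinNorm (N : ℕ) (A : (Fin N → ℝ) →ₗ[ℝ] (Fin N → ℝ) →ₗ[ℝ] ℝ) : ℝ :=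
  sSup { t : ℝ | ∃ x y : Fin N → ℝ, (∀ i, |x i| ≤ 1) ∧ (∀ j, |y j| ≤ 1) ∧ t = |A x y| }

lemma lin_expand {N : ℕ} {M : Type*} [AddCommGroup M] [Module ℝ M]
    (f : (Fin N → ℝ) →ₗ[ℝ] M) (x : Fin N → ℝ) :
    f x = ∑ k, x k • f (Pi.single k 1) := by
  conv_lhs => rw [← Finset.univ_sum_single x]
  rw [map_sum]
  refine Finset.sum_congr rfl fun k _ => ?_
  rw [← map_smul]
  congr 1
  rw [← Pi.single_smul]
  simp

lemma bilin_expand {N : ℕ} (A : (Fin N → ℝ) →ₗ[ℝ] (Fin N → ℝ) →ₗ[ℝ] ℝ) (x y : Fin N → ℝ) :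
    A x y = ∑ k, x k * A (Pi.single k 1) y := by
  rw [lin_expand A x]
  simp

lemma abs_sign_le (t : ℝ) : |(SignType.sign t : ℝ)| ≤ 1 := by
  rcases lt_trichotomy t 0 with h | h | h <;> simp [h]

lemma le_bilinNorm {N : ℕ} (A : (Fin N → ℝ) →ₗ[ℝ] (Fin N → ℝ) →ₗ[ℝ] ℝ) (x y : Fin N → ℝ)
    (hx : ∀ i, |x i| ≤ 1) (hy : ∀ i, |y i| ≤ 1) : |A x y| ≤ bilinNorm N A := by
  apply le_csSup
  · refine ⟨∑ k, ∑ j, |A (Pi.single k 1) (Pi.single j 1)|, ?_⟩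
    rintro t ⟨x, y, hx, hy, rfl⟩
    rw [bilin_expand]
    refine (Finset.abs_sum_le_sum_abs _ _).trans (Finset.sum_le_sum fun k _ => ?_)
    rw [abs_mul]
    refine (mul_le_of_le_one_left (abs_nonneg _) (hx k)).trans ?_
    rw [lin_expand (A (Pi.single k 1)) y]
    refine (Finset.abs_sum_le_sum_abs _ _).trans (Finset.sum_le_sum fun j _ => ?_)
    rw [smul_eq_mul, abs_mul]
    exact mul_le_of_le_one_left (abs_nonneg _) (hy j)
  · exact ⟨x, y, hx, hy, rfl⟩

lemma sum_abs_row_le {N : ℕ} (A : (Fin N → ℝ) →ₗ[ℝ] (Fin N → ℝ) →ₗ[ℝ] ℝ) (y : Fin N → ℝ)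
    (hy : ∀ i, |y i| ≤ 1) : ∑ k, |A (Pi.single k 1) y| ≤ bilinNorm N A := by
  have h := le_bilinNorm A (fun k => (SignType.sign (A (Pi.single k 1) y) : ℝ)) y
    (fun k => abs_sign_le _) hy
  rw [bilin_expand] at h
  refine le_trans ?_ ((le_abs_self _).trans h)
  refine Finset.sum_le_sum fun k _ => ?_
  rw [sign_mul_self]

lemma row_le {N : ℕ} (A : (Fin N → ℝ) →ₗ[ℝ] (Fin N → ℝ) →ₗ[ℝ] ℝ) (k : Fin N) :
    ∑ j, |A (Pi.single k 1) (Pi.single j 1)| ≤ bilinNorm N A := by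
  have h := sum_abs_row_le A
    (fun j => (SignType.sign (A (Pi.single k 1) (Pi.single j 1)) : ℝ)) (fun j => abs_sign_le _)
  refine le_trans ?_ ((Finset.single_le_sum (fun i _ => abs_nonneg _) (Finset.mem_univ k)).trans h)
  rw [lin_expand (A (Pi.single k 1))]
  refine le_trans ?_ (le_abs_self _)
  refine Finset.sum_le_sum fun j _ => ?_
  rw [smul_eq_mul, sign_mul_self]

/-- The real vector attached to a sign pattern. -/
def sgnVec {N : ℕ} (e : Fin N → ℤˣ) : Fin N → ℝ := fun j => ((e j : ℤ) : ℝ)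

lemma abs_sgnVec {N : ℕ} (e : Fin N → ℤˣ) (j : Fin N) : |sgnVec e j| = 1 := by
  rcases Int.units_eq_one_or (e j) with h | h <;> simp [sgnVec, h]

lemma avg_ge {N : ℕ} (f : (Fin N → ℝ) →ₗ[ℝ] ℝ) (j : Fin N) :
    (Fintype.card (Fin N → ℤˣ) : ℝ) * |f (Pi.single j 1)| ≤ ∑ e : Fin N → ℤˣ, |f (sgnVec e)| := by
  set u : Fin N → ℤˣ := Function.update 1 j (-1) with hu
  have h1 : ∑ e : Fin N → ℤˣ, |f (sgnVec (e * u))| = ∑ e : Fin N → ℤˣ, |f (sgnVec e)| :=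
    Equiv.sum_comp (Equiv.mulRight u) (fun e => |f (sgnVec e)|)
  have h2 : ∀ e : Fin N → ℤˣ,
      2 * |f (Pi.single j 1)| ≤ |f (sgnVec e)| + |f (sgnVec (e * u))| := by
    intro e
    have h3 : sgnVec e - sgnVec (e * u) = (2 * sgnVec e j) • Pi.single j (1 : ℝ) := by
      ext i
      by_cases hi : i = j
      · subst hi
        simp [sgnVec, hu]
        ring
      · simp [sgnVec, hu, hi]
    have h4 : f (sgnVec e) - f (sgnVec (e * u)) = (2 * sgnVec e j) * f (Pi.single j 1) := by
      rw [← map_sub, h3, map_smul, smul_eq_mul]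
    have h5 := abs_sub (f (sgnVec e)) (f (sgnVec (e * u)))
    rw [h4, abs_mul, abs_mul, abs_sgnVec] at h5
    simpa using h5
  have h6 := Finset.sum_le_sum (s := Finset.univ) fun e _ => h2 e
  rw [Finset.sum_add_distrib, h1, Finset.sum_const, nsmul_eq_mul, Finset.card_univ] at h6
  linarith

lemma sum_max_le {N : ℕ} (A : (Fin N → ℝ) →ₗ[ℝ] (Fin N → ℝ) →ₗ[ℝ] ℝ) (J : Fin N → Fin N) :
    ∑ k, |A (Pi.single k 1) (Pi.single (J k) 1)| ≤ bilinNorm N A := by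
  have h0 : (0 : ℝ) < Fintype.card (Fin N → ℤˣ) := by exact_mod_cast Fintype.card_pos
  refine le_of_mul_le_mul_left ?_ h0
  rw [Finset.mul_sum]
  refine (Finset.sum_le_sum fun k _ => avg_ge (A (Pi.single k 1)) (J k)).trans ?_
  rw [Finset.sum_comm]
  refine (Finset.sum_le_sum fun e _ => sum_abs_row_le A (sgnVec e)
    fun j => (abs_sgnVec e j).le).trans ?_
  rw [Finset.sum_const, nsmul_eq_mul, Finset.card_univ]

theorem real_anisotropic_littlewood_constant_one (a b : ℝ) (ha : 1 ≤ a) (hb : 1 ≤ b)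
    (hab : 1 / a + 1 / b ≤ 1) (N : ℕ) (hN : 0 < N)
    (A : (Fin N → ℝ) →ₗ[ℝ] (Fin N → ℝ) →ₗ[ℝ] ℝ) :
    (∑ k : Fin N, (∑ j : Fin N, |A (Pi.single k 1) (Pi.single j 1)| ^ a) ^ (b / a)) ^ (1 / b)
      ≤ bilinNorm N A := by
  have ha0 : 0 < a := by linarith
  have hb0 : 0 < b := by linarith
  have : Nonempty (Fin N) := ⟨⟨0, hN⟩⟩
  have hmax : ∀ k : Fin N, ∃ j : Fin N, ∀ i : Fin N,
      |A (Pi.single k 1) (Pi.single i 1)| ≤ |A (Pi.single k 1) (Pi.single j 1)| := fun k =>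
    Finite.exists_max fun i => |A (Pi.single k 1) (Pi.single i 1)|
  choose J hJ using hmax
  have hr := sum_max_le A J
  have hs := row_le A
  set M := bilinNorm N A with hM
  set c : Fin N → Fin N → ℝ := fun k j => |A (Pi.single k 1) (Pi.single j 1)| with hc
  have hc0 : ∀ k j, 0 ≤ c k j := fun k j => abs_nonneg _
  change ∑ k, c k (J k) ≤ M at hr
  change ∀ k, ∑ j, c k j ≤ M at hs
  change ∀ k i, c k i ≤ c k (J k) at hJ
  change (∑ k, (∑ j, c k j ^ a) ^ (b / a)) ^ (1 / b) ≤ M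
  have hM0 : 0 ≤ M := le_trans (Finset.sum_nonneg fun k _ => hc0 k (J k)) hr
  have hrM : ∀ k, c k (J k) ≤ M := fun k =>
    (Finset.single_le_sum (fun j _ => hc0 k j) (Finset.mem_univ (J k))).trans (hs k)
  have hcexp : 1 ≤ (a - 1) * (b / a) := by
    have h1 : b * (1 / a + 1 / b) ≤ b * 1 := mul_le_mul_of_nonneg_left hab hb0.le
    have h2 : b * (1 / a + 1 / b) = b / a + 1 := by field_simp
    have h3 : (a - 1) * (b / a) = b - b / a := by field_simp
    linarith
  have hsplit : ∀ t : ℝ, 0 ≤ t → ∀ p : ℝ, 1 ≤ p → t ^ p = t ^ (p - 1) * t := by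
    intro t ht p hp
    conv_rhs => rw [← Real.rpow_one t, ← Real.rpow_mul ht, one_mul]
    rw [← Real.rpow_add_of_nonneg ht (by linarith) zero_le_one]
    congr 1
    ring
  have hrow : ∀ k, (∑ j, c k j ^ a) ^ (b / a) ≤ M ^ (b - 1) * c k (J k) := by
    intro k
    have h1 : ∑ j, c k j ^ a ≤ c k (J k) ^ (a - 1) * M := by
      calc ∑ j, c k j ^ a ≤ ∑ j, c k (J k) ^ (a - 1) * c k j := by
            refine Finset.sum_le_sum fun j _ => ?_
            rw [hsplit _ (hc0 k j) a ha]
            exact mul_le_mul_of_nonneg_right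
              (Real.rpow_le_rpow (hc0 k j) (hJ k j) (by linarith)) (hc0 k j)
        _ = c k (J k) ^ (a - 1) * ∑ j, c k j := by rw [Finset.mul_sum]
        _ ≤ _ := mul_le_mul_of_nonneg_left (hs k) (Real.rpow_nonneg (hc0 _ _) _)
    have hba : 0 ≤ b / a := by positivity
    calc (∑ j, c k j ^ a) ^ (b / a) ≤ (c k (J k) ^ (a - 1) * M) ^ (b / a) :=
          Real.rpow_le_rpow (Finset.sum_nonneg fun j _ => Real.rpow_nonneg (hc0 _ _) _) h1 hba
      _ = c k (J k) ^ ((a - 1) * (b / a)) * M ^ (b / a) := by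
          rw [Real.mul_rpow (Real.rpow_nonneg (hc0 _ _) _) hM0, ← Real.rpow_mul (hc0 _ _)]
      _ = c k (J k) ^ ((a - 1) * (b / a) - 1) * c k (J k) * M ^ (b / a) := by
          rw [hsplit _ (hc0 _ _) _ hcexp]
      _ ≤ M ^ ((a - 1) * (b / a) - 1) * c k (J k) * M ^ (b / a) := by
          refine mul_le_mul_of_nonneg_right (mul_le_mul_of_nonneg_right
            (Real.rpow_le_rpow (hc0 _ _) (hrM k) (by linarith)) (hc0 _ _))
            (Real.rpow_nonneg hM0 _)
      _ = M ^ ((a - 1) * (b / a) - 1) * M ^ (b / a) * c k (J k) := by ring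
      _ = M ^ (b - 1) * c k (J k) := by
          rw [← Real.rpow_add_of_nonneg hM0 (by linarith) hba]
          congr 2
          field_simp
          ring
  have htot : ∑ k, (∑ j, c k j ^ a) ^ (b / a) ≤ M ^ b := by
    calc _ ≤ ∑ k, M ^ (b - 1) * c k (J k) := Finset.sum_le_sum fun k _ => hrow k
      _ = M ^ (b - 1) * ∑ k, c k (J k) := by rw [Finset.mul_sum]
      _ ≤ M ^ (b - 1) * M := mul_le_mul_of_nonneg_left hr (Real.rpow_nonneg hM0 _)
      _ = M ^ b := (hsplit M hM0 b hb).symm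
  calc _ ≤ (M ^ b) ^ (1 / b) := Real.rpow_le_rpow
        (Finset.sum_nonneg fun k _ => Real.rpow_nonneg
          (Finset.sum_nonneg fun j _ => Real.rpow_nonneg (hc0 _ _) _) _) htot (by positivity)
    _ = M := by rw [← Real.rpow_mul hM0, mul_one_div_cancel hb0.ne', Real.rpow_one]
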